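/- Let T be a k-additive triangulated category with finite-dimensional Hom-spaces, local endomorphism rings of indecomposable objects, which is left locally finite. Then for all objects X, Y, L of T one has (|Hom_T(L,X)_{Y[1]}| / a_X) · ({L,X}/{X,X}) = (|Hom_T(Y,L)_X| / a_Y) · ({Y,L}/{Y,Y}); denoting this common value by F^L_{XY}, the derived Riedtmann–Peng formula holds: F^L_{XY} = |Hom_T(X, Y[1])_{L[1]}| · {X, Y[1]} · ( a_L · {L,L} ) / ( a_X · {X,X} · a_Y · {Y,Y} ). -/

import Mathlib

/-!
STATEMENT 5.
Let `T` be a `k`-additive triangulated category (over a finite field `k`) with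
finite-dimensional Hom-spaces, local endomorphism rings of indecomposable objects,
which is left locally finite.  Then for all objects `X Y L` the two expressions defining
the derived Hall number `F^L_{XY}` agree, and the derived Riedtmann–Peng formula holds.
Here `{X, Y} = ∏_{i>0} |Hom(X[i], Y)|^{(-1)^i}` and `Hom(Y, L)_X` is the set of morphisms
`Y ⟶ L` whose cone is isomorphic to `X`.
-/

open CategoryTheory CategoryTheory.Limits CategoryTheory.Pretriangulated

noncomputable section

namespace GreenDH

def autCard {C : Type*} [Category C] (X : C) : ℕ := Nat.card (Aut X)

variable {T : Type*} [Category T] [Preadditive T] [HasZeroObject T] [HasShift T ℤ]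
  [∀ n : ℤ, (shiftFunctor T n).Additive] [Pretriangulated T]

/-- `|Hom_T(Y, L)_X|`: the number of morphisms `Y ⟶ L` whose cone is isomorphic to `X`,
i.e. which fit in a distinguished triangle `Y ⟶ L ⟶ X ⟶ Y[1]`. -/
def coneHomCard (Y L X : T) : ℕ :=
  Nat.card {l : Y ⟶ L // ∃ (g : L ⟶ X) (h : X ⟶ Y⟦(1 : ℤ)⟧),
    Triangle.mk l g h ∈ distinguishedTriangles (C := T)}

/-- `{X, Y} := ∏_{i > 0} |Hom_T(X[i], Y)|^{(-1)^i}`. -/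
def brace (X Y : T) : ℚ :=
  ∏ᶠ i : ℕ, if 0 < i then (Nat.card (X⟦(i : ℤ)⟧ ⟶ Y) : ℚ) ^ ((-1 : ℤ) ^ i) else 1

section Helpers

set_option linter.unusedSectionVars false
set_option linter.style.haveILetI false

variable {T : Type*} [Category T] [Preadditive T] [HasZeroObject T] [HasShift T ℤ]
  [∀ n : ℤ, (shiftFunctor T n).Additive] [Pretriangulated T]

lemma card_comp_ker {G H K : Type*} [AddCommGroup G] [AddCommGroup H] [AddCommGroup K]
    [Finite G] (φ : G →+ H) (ψ : H →+ K) (p : H → Prop)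
    (hp : ∀ x, p x ↔ (∃ y, φ y = x) ∧ ψ x = 0) :
    Nat.card {x : G // ψ (φ x) = 0} = Nat.card {x : G // φ x = 0} * Nat.card {x : H // p x} := by
  let M : AddSubgroup G := (ψ.comp φ).ker
  let χ : M →+ H := φ.comp M.subtype
  have h1 : Nat.card {x : G // ψ (φ x) = 0} = Nat.card M := rfl
  have h2 : Nat.card {x : G // φ x = 0} = Nat.card χ.ker := by
    refine Nat.card_congr ⟨fun x => ⟨⟨x.1, ?_⟩, ?_⟩, fun x => ⟨x.1.1, ?_⟩, fun _ => rfl, fun _ => rfl⟩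
    · change ψ (φ x.1) = 0
      rw [x.2, map_zero]
    · exact x.2
    · exact x.2
  have h3 : Nat.card {x : H // p x} = Nat.card χ.range := by
    refine Nat.card_congr (Equiv.subtypeEquivRight fun x => ?_)
    rw [hp]
    constructor
    · rintro ⟨⟨y, rfl⟩, h⟩
      exact ⟨⟨y, h⟩, rfl⟩
    · rintro ⟨⟨y, h⟩, rfl⟩
      exact ⟨⟨y, rfl⟩, h⟩
  rw [h1, h2, h3, ← AddSubgroup.index_ker, AddSubgroup.card_mul_index]

lemma card_ker_range {G H : Type*} [AddCommGroup G] [AddCommGroup H]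
    [Finite G] (φ : G →+ H) (p : H → Prop) (hp : ∀ x, p x ↔ ∃ y, φ y = x) :
    Nat.card G = Nat.card {x : G // φ x = 0} * Nat.card {x : H // p x} := by
  rw [← card_comp_ker φ (0 : H →+ H) p (by simpa using hp)]
  exact (Nat.card_congr (Equiv.subtypeUnivEquiv (by simp))).symm

/-- Number of `b : B ⟶ Z` killed by precomposition with `φ`. -/
def Kl {A B : T} (φ : A ⟶ B) (Z : T) : ℕ := Nat.card {b : B ⟶ Z // φ ≫ b = 0}

/-- Number of `a : Z ⟶ A` killed by postcomposition with `φ`. -/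
def Kr {A B : T} (φ : A ⟶ B) (Z : T) : ℕ := Nat.card {a : Z ⟶ A // a ≫ φ = 0}

lemma Kl_neg {A B : T} (φ : A ⟶ B) (Z : T) : Kl (-φ) Z = Kl φ Z := by
  simp [Kl]

lemma Kr_neg {A B : T} (φ : A ⟶ B) (Z : T) : Kr (-φ) Z = Kr φ Z := by
  simp [Kr]

lemma Kr_shift {A B : T} (φ : A ⟶ B) (Z : T) :
    Kr (φ⟦(1 : ℤ)⟧') (Z⟦(1 : ℤ)⟧) = Kr φ Z := by
  symm
  refine Nat.card_congr
    ((Functor.FullyFaithful.ofFullyFaithful (shiftFunctor T (1 : ℤ))).homEquiv.subtypeEquiv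
      fun a => ?_)
  simp only [Functor.FullyFaithful.homEquiv_apply]
  rw [← Functor.map_comp, Functor.map_eq_zero_iff]

section fin
variable [∀ A B : T, Finite (A ⟶ B)]

lemma Kl_pos {A B : T} (φ : A ⟶ B) (Z : T) : 0 < Kl φ Z := by
  haveI : Nonempty {b : B ⟶ Z // φ ≫ b = 0} := ⟨⟨0, by simp⟩⟩
  exact Nat.card_pos

lemma Kr_pos {A B : T} (φ : A ⟶ B) (Z : T) : 0 < Kr φ Z := by
  haveI : Nonempty {b : Z ⟶ A // b ≫ φ = 0} := ⟨⟨0, by simp⟩⟩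
  exact Nat.card_pos

lemma hom_pos (A B : T) : 0 < Nat.card (A ⟶ B) := Nat.card_pos

lemma rot' {Y L X : T} {f : Y ⟶ L} {g : L ⟶ X} {h : X ⟶ Y⟦(1 : ℤ)⟧}
    (H : Triangle.mk f g h ∈ distTriang T) :
    Triangle.mk g h (-f⟦(1 : ℤ)⟧') ∈ distTriang T := rot_of_distTriang _ H

lemma card_l {Y L X : T} {f : Y ⟶ L} {g : L ⟶ X} {h : X ⟶ Y⟦(1 : ℤ)⟧}
    (H : Triangle.mk f g h ∈ distTriang T) (Z : T) :
    Nat.card (X ⟶ Z) = Kl g Z * Kl f Z := by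
  refine card_ker_range (Preadditive.leftComp Z g) (fun b : L ⟶ Z => f ≫ b = 0) fun b => ?_
  constructor
  · intro hb
    obtain ⟨c, hc⟩ := Triangle.yoneda_exact₂ _ H b hb
    exact ⟨c, hc.symm⟩
  · rintro ⟨c, rfl⟩
    have this : f ≫ g = 0 := comp_distTriang_mor_zero₁₂ _ H
    change f ≫ g ≫ c = 0
    rw [reassoc_of% this, zero_comp]

lemma card_r {Y L X : T} {f : Y ⟶ L} {g : L ⟶ X} {h : X ⟶ Y⟦(1 : ℤ)⟧}
    (H : Triangle.mk f g h ∈ distTriang T) (Z : T) :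
    Nat.card (Z ⟶ Y) = Kr f Z * Kr g Z := by
  refine card_ker_range (Preadditive.rightComp Z f) (fun b : Z ⟶ L => b ≫ g = 0) fun b => ?_
  constructor
  · intro hb
    obtain ⟨c, hc⟩ := Triangle.coyoneda_exact₂ _ H b hb
    exact ⟨c, hc.symm⟩
  · rintro ⟨c, rfl⟩
    have this : f ≫ g = 0 := comp_distTriang_mor_zero₁₂ _ H
    change (c ≫ f) ≫ g = 0
    rw [Category.assoc, this, comp_zero]

lemma card_hom_congr {A A' B B' : T} (e : A ≅ A') (e' : B ≅ B') :
    Nat.card (A ⟶ B) = Nat.card (A' ⟶ B') := Nat.card_congr (e.homCongr e')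

lemma card_hom_shift (A B : T) (n : ℤ) :
    Nat.card (A⟦n⟧ ⟶ B⟦n⟧) = Nat.card (A ⟶ B) :=
  (Nat.card_congr
    (Functor.FullyFaithful.ofFullyFaithful (shiftFunctor T n)).homEquiv).symm

lemma card_shift_succ (A B : T) (i : ℕ) :
    Nat.card (A⟦((i + 1 : ℕ) : ℤ)⟧ ⟶ B) = Nat.card ((A⟦(1 : ℤ)⟧)⟦(i : ℤ)⟧ ⟶ B) :=
  card_hom_congr ((shiftFunctorAdd' T (1 : ℤ) (i : ℤ) ((i + 1 : ℕ) : ℤ)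
    (by push_cast; ring)).app A) (Iso.refl _)

lemma brace_shift_shift (A B : T) : brace (A⟦(1 : ℤ)⟧) (B⟦(1 : ℤ)⟧) = brace A B := by
  unfold brace
  refine finprod_congr fun i => ?_
  rw [card_hom_congr (shiftComm A (1 : ℤ) (i : ℤ)) (Iso.refl _), card_hom_shift]

/-- Vanishing from degree `n` on. -/
def Van (A B : T) (n : ℕ) : Prop := ∀ i : ℕ, n ≤ i → Nat.card (A⟦(i : ℤ)⟧ ⟶ B) = 1

lemma Van.shift {A B : T} {n : ℕ} (h : Van A B (n + 1)) : Van (A⟦(1 : ℤ)⟧) B n := by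
  intro i hi
  rw [← card_shift_succ]
  exact h _ (by omega)

lemma brace_eq_prod {A B : T} {n : ℕ} (h : Van A B (n + 1)) :
    brace A B = ∏ i ∈ Finset.range n,
      (Nat.card (A⟦((i + 1 : ℕ) : ℤ)⟧ ⟶ B) : ℚ) ^ ((-1 : ℤ) ^ (i + 1)) := by
  unfold brace
  rw [finprod_eq_prod_of_mulSupport_subset (s := Finset.range (n + 1))]
  · rw [Finset.prod_range_succ']
    simp
  · intro i hi
    by_contra hc
    simp only [Finset.coe_range, Set.mem_Iio, not_lt] at hc
    apply hi
    dsimp only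
    rw [h i hc]
    simp

lemma brace_succ {A B : T} {n : ℕ} (h : Van A B (n + 1)) :
    brace A B = (Nat.card (A⟦(1 : ℤ)⟧ ⟶ B) : ℚ)⁻¹ * (brace (A⟦(1 : ℤ)⟧) B)⁻¹ := by
  have h' : Van A B (n + 1 + 1) := fun i hi => h i (by omega)
  rw [brace_eq_prod h', brace_eq_prod h'.shift, Finset.prod_range_succ', mul_comm]
  congr 1
  · simp
  · rw [← Finset.prod_inv_distrib]
    refine Finset.prod_congr rfl fun i _ => ?_
    rw [card_shift_succ A B (i + 1), ← zpow_neg]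
    congr 1
    ring

lemma brace_ne_zero {A B : T} {n : ℕ} (h : Van A B n) : brace A B ≠ 0 := by
  have h' : Van A B (n + 1) := fun i hi => h i (by omega)
  rw [brace_eq_prod h', Finset.prod_ne_zero_iff]
  intro i _
  refine zpow_ne_zero _ ?_
  exact_mod_cast (hom_pos _ _).ne'

lemma brace_zero {A B : T} (h : Van A B 0) : brace A B = 1 := by
  rw [brace_eq_prod (n := 0) (fun i _ => h i (by omega))]
  simp

lemma Van.hom {A B : T} (h : Van A B 0) : Subsingleton (A ⟶ B) := by
  have this : Nat.card (A⟦(0 : ℤ)⟧ ⟶ B) = 1 := h 0 le_rfl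
  rw [card_hom_congr (A' := A) (B' := B) ((shiftFunctorZero T ℤ).app A) (Iso.refl _)] at this
  exact (Nat.card_eq_one_iff_unique.1 this).1

lemma brace_l (n : ℕ) : ∀ {Y L X : T} {f : Y ⟶ L} {g : L ⟶ X} {h : X ⟶ Y⟦(1 : ℤ)⟧}
    (_ : Triangle.mk f g h ∈ distTriang T) (Z : T)
    (_ : Van Y Z n) (_ : Van L Z n) (_ : Van X Z n),
    brace L Z = brace X Z * brace Y Z * Kl g Z := by
  induction n with
  | zero =>
    intro Y L X f g h H Z hY hL hX
    rw [brace_zero hY, brace_zero hL, brace_zero hX]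
    haveI := hX.hom
    have : Kl g Z = 1 := by
      haveI : Nonempty {b : X ⟶ Z // g ≫ b = 0} := ⟨⟨0, by simp⟩⟩
      exact Nat.card_eq_one_iff_unique.2 ⟨inferInstance, inferInstance⟩
    simp [this]
  | succ n ih =>
    intro Y L X f g h H Z hY hL hX
    have H1 := rot' H
    have H2 := rot' H1
    have H3 := rot' H2
    have e := ih H3 Z hY.shift hL.shift hX.shift
    have e1 := card_l H1 Z
    have e2 := card_l H2 Z
    have e3 := card_l H3 Z
    rw [Kl_neg] at e e2 e3
    rw [Kl_neg] at e3
    rw [brace_succ hY, brace_succ hL, brace_succ hX, e, e1, e2, e3]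
    have p1 : (Kl g Z : ℚ) ≠ 0 := by exact_mod_cast (Kl_pos g Z).ne'
    have p2 : (Kl h Z : ℚ) ≠ 0 := by exact_mod_cast (Kl_pos h Z).ne'
    have p3 : (Kl (f⟦(1 : ℤ)⟧') Z : ℚ) ≠ 0 := by exact_mod_cast (Kl_pos _ Z).ne'
    have p4 : (Kl (g⟦(1 : ℤ)⟧') Z : ℚ) ≠ 0 := by exact_mod_cast (Kl_pos _ Z).ne'
    have p5 := brace_ne_zero hY.shift
    have p6 := brace_ne_zero hX.shift
    push_cast
    field_simp

lemma brace_r (n : ℕ) : ∀ {Y L X : T} {f : Y ⟶ L} {g : L ⟶ X} {h : X ⟶ Y⟦(1 : ℤ)⟧}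
    (_ : Triangle.mk f g h ∈ distTriang T) (Z : T)
    (_ : Van Z Y n) (_ : Van Z L n) (_ : Van Z X n),
    brace Z L = brace Z X * brace Z Y * Kr f Z := by
  induction n with
  | zero =>
    intro Y L X f g h H Z hY hL hX
    rw [brace_zero hY, brace_zero hL, brace_zero hX]
    haveI := hY.hom
    have : Kr f Z = 1 := by
      haveI : Nonempty {b : Z ⟶ Y // b ≫ f = 0} := ⟨⟨0, by simp⟩⟩
      exact Nat.card_eq_one_iff_unique.2 ⟨inferInstance, inferInstance⟩
    simp [this]
  | succ n ih =>
    intro Y L X f g h H Z hY hL hX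
    have H1 := rot' H
    have H2 := rot' H1
    have e := ih H (Z⟦(1 : ℤ)⟧) hY.shift hL.shift hX.shift
    have e1 := card_r H (Z⟦(1 : ℤ)⟧)
    have e2 := card_r H1 (Z⟦(1 : ℤ)⟧)
    have e3 := card_r H2 (Z⟦(1 : ℤ)⟧)
    rw [Kr_neg, Kr_shift] at e3
    rw [brace_succ hY, brace_succ hL, brace_succ hX, e, e1, e2, e3]
    have p1 : (Kr g (Z⟦(1 : ℤ)⟧) : ℚ) ≠ 0 := by exact_mod_cast (Kr_pos _ _).ne'
    have p2 : (Kr h (Z⟦(1 : ℤ)⟧) : ℚ) ≠ 0 := by exact_mod_cast (Kr_pos _ _).ne'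
    have p3 : (Kr f Z : ℚ) ≠ 0 := by exact_mod_cast (Kr_pos _ Z).ne'
    have p4 : (Kr f (Z⟦(1 : ℤ)⟧) : ℚ) ≠ 0 := by exact_mod_cast (Kr_pos _ _).ne'
    have p5 := brace_ne_zero hY.shift
    have p6 := brace_ne_zero hX.shift
    push_cast
    field_simp

/-- The set of distinguished triangles on `Y, L, X`. -/
@[ext]
structure Tri (Y L X : T) where
  f : Y ⟶ L
  g : L ⟶ X
  h : X ⟶ Y⟦(1 : ℤ)⟧
  H : Triangle.mk f g h ∈ distTriang T

instance (Y L X : T) : Finite (Tri Y L X) :=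
  Finite.of_injective (fun w : Tri Y L X => (w.f, w.g, w.h)) fun w w' h => by
    simp only [Prod.mk.injEq] at h
    exact Tri.ext h.1 h.2.1 h.2.2

/-- Changing the third object of a triangle by an automorphism. -/
lemma dist_iso {Y L X : T} {f : Y ⟶ L} {g : L ⟶ X} {h : X ⟶ Y⟦(1 : ℤ)⟧}
    (H : Triangle.mk f g h ∈ distTriang T) (a : X ≅ X) :
    Triangle.mk f (g ≫ a.hom) (a.inv ≫ h) ∈ distTriang T := by
  refine isomorphic_distinguished _ H _ ?_
  refine Triangle.isoMk _ _ (Iso.refl Y) (Iso.refl L) a.symm ?_ ?_ ?_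
  · change f ≫ 𝟙 L = 𝟙 Y ≫ f
    simp
  · change (g ≫ a.hom) ≫ a.inv = 𝟙 L ≫ g
    simp
  · change (a.inv ≫ h) ≫ (shiftFunctor T (1 : ℤ)).map (𝟙 Y) = a.inv ≫ h
    simp

/-- `Aut X` acts on triangles. -/
instance (Y L X : T) : MulAction (Aut X) (Tri Y L X) where
  smul a w := ⟨w.f, w.g ≫ Iso.hom a, Iso.inv a ≫ w.h, dist_iso w.H a⟩
  one_smul w := by
    apply Tri.ext
    · rfl
    · exact Category.comp_id w.g
    · exact Category.id_comp w.h
  mul_smul a b w := by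
    apply Tri.ext
    · rfl
    · exact (Category.assoc w.g (Iso.hom b) (Iso.hom a)).symm
    · exact Category.assoc (Iso.inv a) (Iso.inv b) w.h

lemma smul_f {Y L X : T} (a : Aut X) (w : Tri Y L X) : (a • w).f = w.f := rfl
lemma smul_g {Y L X : T} (a : X ≅ X) (w : Tri Y L X) :
    Tri.g ((show Aut X from a) • w) = w.g ≫ a.hom := rfl
lemma smul_h {Y L X : T} (a : X ≅ X) (w : Tri Y L X) :
    Tri.h ((show Aut X from a) • w) = a.inv ≫ w.h := rfl

lemma smul_eq_iff {Y L X : T} (a : X ≅ X) (w w' : Tri Y L X) :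
    (show Aut X from a) • w = w' ↔ w.f = w'.f ∧ w.g ≫ a.hom = w'.g ∧ w.h = a.hom ≫ w'.h := by
  rw [Tri.ext_iff, smul_f, smul_g, smul_h, Iso.inv_comp_eq]

instance (X : T) : Finite (Aut X) :=
  Finite.of_injective (fun a : Aut X => Iso.hom a) fun _ _ h => Iso.ext h

lemma exists_smul {Y L X : T} (w w' : Tri Y L X) (h : w.f = w'.f) :
    ∃ a : Aut X, a • w = w' := by
  let e := isoTriangleOfIso₁₂ _ _ w.H w'.H (Iso.refl Y) (Iso.refl L)
    (show w.f ≫ 𝟙 L = 𝟙 Y ≫ w'.f by simp [h])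
  let a : X ≅ X := Triangle.π₃.mapIso e
  have e2 : w.g ≫ a.hom = 𝟙 L ≫ w'.g := e.hom.comm₂
  have e3 : w.h ≫ (shiftFunctor T (1 : ℤ)).map (𝟙 Y) = a.hom ≫ w'.h := e.hom.comm₃
  refine ⟨a, (smul_eq_iff a w w').2 ⟨h, ?_, ?_⟩⟩
  · simpa using e2
  · simpa using e3

/-- Square-zero endomorphisms stabilising the triangle. -/
def E {Y L X : T} (w : Tri Y L X) : ℕ :=
  Nat.card {e : X ⟶ X // w.g ≫ e = 0 ∧ e ≫ w.h = 0}

lemma E_sq {Y L X : T} (w : Tri Y L X) (e : X ⟶ X) (h1 : w.g ≫ e = 0)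
    (h2 : e ≫ w.h = 0) : e ≫ e = 0 := by
  obtain ⟨b, hb⟩ : ∃ b : Y⟦(1 : ℤ)⟧ ⟶ X, e = w.h ≫ b :=
    Triangle.yoneda_exact₃ _ w.H e h1
  calc e ≫ e = e ≫ (w.h ≫ b) := by rw [← hb]
    _ = 0 := by rw [reassoc_of% h2, zero_comp]

/-- The automorphism `1 + e` for `e` of square zero. -/
def unip {X : T} (e : X ⟶ X) (h : e ≫ e = 0) : X ≅ X where
  hom := 𝟙 X + e
  inv := 𝟙 X - e
  hom_inv_id := by simp [h]
  inv_hom_id := by simp [h]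

lemma card_stab {Y L X : T} (w : Tri Y L X) :
    Nat.card {a : Aut X // a • w = w} = E w := by
  refine Nat.card_congr ⟨fun a => ⟨Iso.hom a.1 - 𝟙 X, ?_⟩,
    fun e => ⟨unip e.1 (E_sq w e.1 e.2.1 e.2.2), ?_⟩, fun a => ?_, fun e => ?_⟩
  · obtain ⟨-, h2, h3⟩ := (smul_eq_iff a.1 w w).1 a.2
    constructor
    · rw [Preadditive.comp_sub, h2, Category.comp_id, sub_self]
    · rw [Preadditive.sub_comp, ← h3, Category.id_comp, sub_self]
  · refine (smul_eq_iff _ w w).2 ⟨rfl, ?_, ?_⟩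
    · simp [unip, e.2.1]
    · simp [unip, e.2.2]
  · apply Subtype.ext
    apply Iso.ext
    simp [unip]
  · apply Subtype.ext
    simp [unip]

lemma card_orbits (Y L X : T) :
    Nat.card (MulAction.orbitRel.Quotient (Aut X) (Tri Y L X)) = coneHomCard Y L X := by
  refine Nat.card_congr (Equiv.ofBijective (Quotient.lift (fun w => ⟨w.f, w.g, w.h, w.H⟩)
    ?_) ⟨?_, ?_⟩)
  · rintro w w' ⟨a, rfl⟩
    rfl
  · intro x y
    induction x using Quotient.inductionOn with | _ w
    induction y using Quotient.inductionOn with | _ w'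
    intro h
    have h' : w.f = w'.f := congrArg Subtype.val h
    obtain ⟨a, ha⟩ := exists_smul w' w h'.symm
    exact Quotient.sound ⟨a, ha⟩
  · rintro ⟨f, g, h, H⟩
    exact ⟨Quotient.mk _ ⟨f, g, h, H⟩, rfl⟩

lemma burnside (Y L X : T) :
    ∑ᶠ w : Tri Y L X, E w = coneHomCard Y L X * autCard X := by
  haveI := Fintype.ofFinite (Tri Y L X)
  rw [← card_orbits, autCard, ← Nat.card_prod,
    ← Nat.card_congr (MulAction.sigmaFixedByEquivOrbitsProdGroup (Aut X) (Tri Y L X)),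
    finsum_eq_sum_of_fintype]
  have : (Σ a : Aut X, MulAction.fixedBy (Tri Y L X) a) ≃
      Σ w : Tri Y L X, {a : Aut X // a • w = w} :=
    ⟨fun z => ⟨z.2.1, z.1, z.2.2⟩, fun z => ⟨z.2.1, z.1, z.2.2⟩, fun _ => rfl, fun _ => rfl⟩
  rw [Nat.card_congr this, Nat.card_sigma]
  exact Finset.sum_congr rfl fun w _ => (card_stab w).symm

/-- Rotation of triangles as a bijection. -/
def rotEquiv (Y L X : T) : Tri Y L X ≃ Tri L X (Y⟦(1 : ℤ)⟧) :=
  Equiv.ofBijective (fun w => ⟨w.g, w.h, -w.f⟦(1 : ℤ)⟧', rot' w.H⟩) (by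
    constructor
    · intro w w' h
      simp only [Tri.mk.injEq, neg_inj] at h
      obtain ⟨h1, h2, h3⟩ := h
      exact Tri.ext ((shiftFunctor T (1 : ℤ)).map_injective h3) h1 h2
    · rintro ⟨g, h, m, H⟩
      obtain ⟨f, hf⟩ := (shiftFunctor T (1 : ℤ)).map_surjective (-m)
      obtain rfl : m = -f⟦(1 : ℤ)⟧' := by rw [hf, neg_neg]
      exact ⟨⟨f, g, h, (rotate_distinguished_triangle _).2 H⟩, rfl⟩)

lemma autCard_shift (Y : T) : autCard (Y⟦(1 : ℤ)⟧) = autCard Y :=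
  (Nat.card_congr ((Functor.FullyFaithful.ofFullyFaithful
    (shiftFunctor T (1 : ℤ))).autMulEquivOfFullyFaithful Y).toEquiv).symm

lemma autCard_pos (X : T) : 0 < autCard X := Nat.card_pos

lemma E_mul {Y L X : T} (w : Tri Y L X) :
    E w * Kl w.h X = E (rotEquiv Y L X w) * Kr w.h (Y⟦(1 : ℤ)⟧) := by
  obtain ⟨f, g, h, H⟩ := w
  have a1 := card_comp_ker (Preadditive.leftComp X h) (Preadditive.rightComp X h)
    (fun e : X ⟶ X => g ≫ e = 0 ∧ e ≫ h = 0) (fun e => by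
      refine and_congr ⟨fun he => ?_, ?_⟩ Iff.rfl
      · obtain ⟨c, hc⟩ := Triangle.yoneda_exact₃ _ H e he
        exact ⟨c, hc.symm⟩
      · rintro ⟨c, rfl⟩
        have this : g ≫ h = 0 := comp_distTriang_mor_zero₂₃ _ H
        change g ≫ h ≫ c = 0
        rw [reassoc_of% this, zero_comp])
  have a2 := card_comp_ker (Preadditive.rightComp (Y⟦(1 : ℤ)⟧) h)
    (Preadditive.leftComp (Y⟦(1 : ℤ)⟧) h)
    (fun e : Y⟦(1 : ℤ)⟧ ⟶ Y⟦(1 : ℤ)⟧ => h ≫ e = 0 ∧ e ≫ (-f⟦(1 : ℤ)⟧') = 0) (fun e => by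
      rw [and_comm]
      refine and_congr ⟨fun he => ?_, ?_⟩ Iff.rfl
      · obtain ⟨c, hc⟩ := Triangle.coyoneda_exact₃ _ (rot' H) e he
        exact ⟨c, hc.symm⟩
      · rintro ⟨c, rfl⟩
        have this : h ≫ (-f⟦(1 : ℤ)⟧') = 0 := comp_distTriang_mor_zero₂₃ _ (rot' H)
        change (c ≫ h) ≫ (-f⟦(1 : ℤ)⟧') = 0
        rw [Category.assoc, this, comp_zero])
  have a3 : Nat.card {b : Y⟦(1 : ℤ)⟧ ⟶ X //
      Preadditive.rightComp X h (Preadditive.leftComp X h b) = 0} =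
      Nat.card {b : Y⟦(1 : ℤ)⟧ ⟶ X // Preadditive.leftComp (Y⟦(1 : ℤ)⟧) h
        (Preadditive.rightComp (Y⟦(1 : ℤ)⟧) h b) = 0} := by
    refine Nat.card_congr (Equiv.subtypeEquivRight fun b => ?_)
    change (h ≫ b) ≫ h = 0 ↔ h ≫ b ≫ h = 0
    rw [Category.assoc]
  rw [a1, a2] at a3
  rw [mul_comm (E _), mul_comm (E _)]
  exact a3

lemma term_eq {Y L X : T} (w : Tri Y L X) :
    E (rotEquiv Y L X w) * Kl w.g X = E w * Kr w.f Y := by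
  have e := E_mul w
  have e1 := card_l (rot' w.H) X
  have e2 := card_r (rot' (rot' w.H)) (Y⟦(1 : ℤ)⟧)
  have e2' := card_r (rot' w.H) (Y⟦(1 : ℤ)⟧)
  have e3 := card_r (rot' (rot' w.H)) (Y⟦(1 : ℤ)⟧)
  rw [Kr_neg, Kr_shift] at e3
  have p1 := Kl_pos w.h X
  have p2 := Kr_pos w.h (Y⟦(1 : ℤ)⟧)
  have hh := e1.symm.trans e3
  apply Nat.eq_of_mul_eq_mul_right (Nat.mul_pos p1 p2)
  calc _ = (E (rotEquiv Y L X w) * Kr w.h (Y⟦(1 : ℤ)⟧)) *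
        (Kl w.h X * Kl w.g X) := by ring
    _ = (E w * Kl w.h X) * (Kr w.h (Y⟦(1 : ℤ)⟧) * Kr w.f Y) := by rw [hh, e]
    _ = _ := by ring

lemma toen (hV : ∀ A B : T, ∃ n, Van A B n) (X Y L : T) :
    ((coneHomCard L X (Y⟦(1 : ℤ)⟧) : ℚ) / (autCard X : ℚ)) * (brace L X / brace X X)
      = ((coneHomCard Y L X : ℚ) / (autCard Y : ℚ)) * (brace Y L / brace Y Y) := by
  haveI := Fintype.ofFinite (Tri Y L X)
  have nz : ∀ A B : T, brace A B ≠ 0 := fun A B => by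
    obtain ⟨n, hn⟩ := hV A B
    exact brace_ne_zero hn
  have b1 := burnside Y L X
  have b2 := burnside L X (Y⟦(1 : ℤ)⟧)
  rw [autCard_shift, ← finsum_comp_equiv (rotEquiv Y L X)] at b2
  rw [finsum_eq_sum_of_fintype] at b1 b2
  have key : ∀ w : Tri Y L X, (E (rotEquiv Y L X w) : ℚ) * (brace L X / brace X X) =
      E w * (brace Y L / brace Y Y) := by
    intro w
    obtain ⟨n1, h1⟩ := hV Y X
    obtain ⟨n2, h2⟩ := hV L X
    obtain ⟨n3, h3⟩ := hV X X
    obtain ⟨n4, h4⟩ := hV Y Y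
    obtain ⟨n5, h5⟩ := hV Y L
    have l := brace_l (n1 + n2 + n3) w.H X (fun i hi => h1 i (by omega))
      (fun i hi => h2 i (by omega)) (fun i hi => h3 i (by omega))
    have r := brace_r (n1 + n4 + n5) w.H Y (fun i hi => h4 i (by omega))
      (fun i hi => h5 i (by omega)) (fun i hi => h1 i (by omega))
    have t : (E (rotEquiv Y L X w) : ℚ) * Kl w.g X = E w * Kr w.f Y := by
      exact_mod_cast term_eq w
    rw [l, r]
    have := nz X X
    have := nz Y Y
    field_simp
    linear_combination brace Y X * t
  have s : (coneHomCard L X (Y⟦(1 : ℤ)⟧) : ℚ) * autCard Y * (brace L X / brace X X) =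
      (coneHomCard Y L X : ℚ) * autCard X * (brace Y L / brace Y Y) := by
    have c1 : (∑ w : Tri Y L X, (E w : ℚ)) = coneHomCard Y L X * autCard X := by exact_mod_cast b1
    have c2 : (∑ w, (E (rotEquiv Y L X w) : ℚ)) =
      coneHomCard L X (Y⟦(1 : ℤ)⟧) * autCard Y := by exact_mod_cast b2
    rw [← c1, ← c2, Finset.sum_mul, Finset.sum_mul]
    exact Finset.sum_congr rfl fun w _ => key w
  have q1 : (autCard X : ℚ) ≠ 0 := by exact_mod_cast (autCard_pos X).ne'
  have q2 : (autCard Y : ℚ) ≠ 0 := by exact_mod_cast (autCard_pos Y).ne'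
  rw [div_mul_eq_mul_div, div_mul_eq_mul_div, div_eq_div_iff q1 q2]
  linear_combination s

end fin
end Helpers

theorem toen_formula_and_derived_riedtmann_peng
    (k : Type) [Field k] [Fintype k]
    (T : Type*) [Category T] [Preadditive T] [CategoryTheory.Linear k T]
    [HasZeroObject T] [HasShift T ℤ] [∀ n : ℤ, (shiftFunctor T n).Additive]
    [Pretriangulated T] [HasBinaryBiproducts T]
    -- (i) finite-dimensional Hom-spaces over the finite field `k`
    (hfin : ∀ X Y : T, Module.Finite k (X ⟶ Y))
    -- (ii) local endomorphism rings of indecomposables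
    (hloc : ∀ X : T, Indecomposable X → IsLocalRing (End X))
    -- (iii) left locally finite: `∑_{i ≥ 0} dim Hom(X[i], Y) < ∞`
    (hllf : ∀ X Y : T, Set.Finite {i : ℕ | ¬ Subsingleton (X⟦(i : ℤ)⟧ ⟶ Y)})
    (X Y L : T) :
    -- the two expressions for `F^L_{XY}` agree
    ((coneHomCard L X (Y⟦(1 : ℤ)⟧) : ℚ) / (autCard X : ℚ)) * (brace L X / brace X X)
      = ((coneHomCard Y L X : ℚ) / (autCard Y : ℚ)) * (brace Y L / brace Y Y)
    -- the derived Riedtmann–Peng formula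
    ∧ ((coneHomCard Y L X : ℚ) / (autCard Y : ℚ)) * (brace Y L / brace Y Y)
      = (coneHomCard X (Y⟦(1 : ℤ)⟧) (L⟦(1 : ℤ)⟧) : ℚ) * brace X (Y⟦(1 : ℤ)⟧) *
          ((autCard L : ℚ) * brace L L) /
          ((autCard X : ℚ) * brace X X * ((autCard Y : ℚ) * brace Y Y)) := by
  haveI : ∀ A B : T, Finite (A ⟶ B) := fun A B => by
    haveI := hfin A B
    exact Module.finite_of_finite k
  have hV : ∀ A B : T, ∃ n, Van A B n := by
    intro A B
    obtain ⟨n, hn⟩ := (hllf A B).bddAbove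
    refine ⟨n + 1, fun i hi => ?_⟩
    have : Subsingleton (A⟦(i : ℤ)⟧ ⟶ B) := by
      by_contra hc
      have : i ≤ n := hn hc
      omega
    exact Nat.card_eq_one_iff_unique.2 ⟨this, ⟨0⟩⟩
  have nz : ∀ A B : T, brace A B ≠ 0 := fun A B => by
    obtain ⟨n, hn⟩ := hV A B
    exact brace_ne_zero hn
  have az : ∀ A : T, (autCard A : ℚ) ≠ 0 := fun A => by
    exact_mod_cast (autCard_pos A).ne'
  have t1 := toen hV X Y L
  refine ⟨t1, ?_⟩
  rw [← t1]
  have t2 := toen hV (Y⟦(1 : ℤ)⟧) L X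
  rw [autCard_shift, brace_shift_shift] at t2
  have := nz X X
  have := nz Y Y
  have := nz L L
  have := az X
  have := az Y
  have := az L
  field_simp at t2 ⊢
  linear_combination -t2

end GreenDH
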